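/- Sharpness of the exponent in the multilinear Buckley bound: Let r_1,…,r_m ∈ (0,∞) and p_1,…,p_m ∈ (0,∞] with r_j < p_j for all j, and 1/p = Σ_{j=1}^m 1/p_j. Suppose α ≥ 0 and C > 0 are such that for all weights w_1,…,w_m on ℝ (dimension n = 1) with [w⃗]_{p⃗,(r⃗,∞)} < ∞ and all f_j ∈ L^{p_j}(w_j^{p_j}) one has ‖M_{(r_1,…,r_m)}(f_1,…,f_m)‖_{L^p(w^p)} ≤ C·[w⃗]_{p⃗,(r⃗,∞)}^α ∏_{j=1}^m ‖f_j‖_{L^{p_j}(w_j^{p_j})}. Then α ≥ max_{j=1,…,m} (1/r_j)/(1/r_j−1/p_j). -/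

import Mathlib

open MeasureTheory ENNReal

noncomputable section

namespace Paper

/-- An axis-parallel (half-open) cube in `ℝⁿ` with positive side length. -/
def IsCube {n : ℕ} (Q : Set (Fin n → ℝ)) : Prop :=
  ∃ (c : Fin n → ℝ) (h : ℝ), 0 < h ∧
    Q = Set.univ.pi fun i => Set.Ico (c i) (c i + h)

/-- A weight on `ℝⁿ`: a measurable, everywhere positive function. -/
def IsWeight {n : ℕ} (w : (Fin n → ℝ) → ℝ) : Prop :=
  Measurable w ∧ ∀ x, 0 < w x

/-- `expOf ρ` is the exponent `1/ρ ∈ (0,∞]`; `ρ = 0` encodes the exponent `∞`. -/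
def expOf (ρ : ℝ) : ℝ≥0∞ := if ρ = 0 then ∞ else ENNReal.ofReal (1 / ρ)

/-- The average `⟨f⟩_{1/τ, Q}` of a real-valued `f` over `Q`;
`τ = 0` encodes the essential supremum `⟨f⟩_{∞,Q}`. -/
def avg {n : ℕ} (τ : ℝ) (f : (Fin n → ℝ) → ℝ) (Q : Set (Fin n → ℝ)) : ℝ≥0∞ :=
  if τ = 0 then essSup (fun x => ENNReal.ofReal |f x|) (volume.restrict Q)
  else ((volume Q)⁻¹ * ∫⁻ x in Q, ENNReal.ofReal |f x| ^ (1 / τ)) ^ τ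

/-- The average `⟨g⟩_{1/τ, Q}` of an `ℝ≥0∞`-valued `g` over `Q`. -/
def avgE {n : ℕ} (τ : ℝ) (g : (Fin n → ℝ) → ℝ≥0∞) (Q : Set (Fin n → ℝ)) : ℝ≥0∞ :=
  if τ = 0 then essSup g (volume.restrict Q)
  else ((volume Q)⁻¹ * ∫⁻ x in Q, g x ^ (1 / τ)) ^ τ

/-- The weighted norm `‖f‖_{L^{1/ρ}(w^{1/ρ})} = ‖f·w‖_{L^{1/ρ}(ℝⁿ)}`;
`ρ = 0` encodes `p = ∞`. -/
def wnorm {n : ℕ} (ρ : ℝ) (f w : (Fin n → ℝ) → ℝ) : ℝ≥0∞ :=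
  eLpNorm (fun x => f x * w x) (expOf ρ) volume

/-- The weighted norm `‖g·w‖_{L^{1/ρ}}` of an `ℝ≥0∞`-valued function `g`. -/
def wnormE {n : ℕ} (ρ : ℝ) (g : (Fin n → ℝ) → ℝ≥0∞) (w : (Fin n → ℝ) → ℝ) : ℝ≥0∞ :=
  if ρ = 0 then essSup (fun x => g x * ENNReal.ofReal (w x)) volume
  else (∫⁻ x, (g x * ENNReal.ofReal (w x)) ^ (1 / ρ)) ^ ρ

/-- The weak weighted norm `‖f‖_{L^{1/ρ,∞}(w^{1/ρ})}
  = sup_{t>0} t · (∫_{|f|>t} w^{1/ρ})^{ρ}`; `ρ = 0` encodes `p = ∞`. -/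
def wWeakNorm {n : ℕ} (ρ : ℝ) (f w : (Fin n → ℝ) → ℝ) : ℝ≥0∞ :=
  if ρ = 0 then wnorm 0 f w
  else ⨆ t : Set.Ioi (0 : ℝ),
    ENNReal.ofReal t.1 *
      (∫⁻ x in {x | t.1 < |f x|}, ENNReal.ofReal (w x) ^ (1 / ρ)) ^ ρ

/-- The weak weighted norm of an `ℝ≥0∞`-valued function. -/
def wWeakNormE {n : ℕ} (ρ : ℝ) (g : (Fin n → ℝ) → ℝ≥0∞) (w : (Fin n → ℝ) → ℝ) : ℝ≥0∞ :=
  if ρ = 0 then essSup (fun x => g x * ENNReal.ofReal (w x)) volume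
  else ⨆ t : Set.Ioi (0 : ℝ),
    ENNReal.ofReal t.1 *
      (∫⁻ x in {x | ENNReal.ofReal t.1 < g x}, ENNReal.ofReal (w x) ^ (1 / ρ)) ^ ρ

/-- The weak `L¹(ℝⁿ)` quasinorm (with respect to Lebesgue measure) of an
`ℝ≥0∞`-valued function. -/
def weakL1 {n : ℕ} (g : (Fin n → ℝ) → ℝ≥0∞) : ℝ≥0∞ :=
  ⨆ t : Set.Ioi (0 : ℝ), ENNReal.ofReal t.1 * volume {x | ENNReal.ofReal t.1 < g x}

/-- The limited range multilinear weight constant `[w⃗]_{p⃗,(r⃗,s)}`, written in terms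
of the reciprocal exponents `rinv j = 1/r_j`, `pinv j = 1/p_j` and `sinv = 1/s`. -/
def wConst {n m : ℕ} (rinv pinv : Fin m → ℝ) (sinv : ℝ)
    (w : Fin m → (Fin n → ℝ) → ℝ) : ℝ≥0∞ :=
  ⨆ Q : {Q : Set (Fin n → ℝ) // IsCube Q},
    (∏ j, avg (rinv j - pinv j) (fun x => (w j x)⁻¹) Q.1) *
      avg ((∑ j, pinv j) - sinv) (fun x => ∏ j, w j x) Q.1

/-- The symmetric weight constant `[w⃗]_{p⃗,(r⃗,∞)} = sup_Q ∏_j ⟨w_j⁻¹⟩_{1/(1/r_j - 1/p_j),Q}`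
for tuples of weights with `∏_j w_j = 1`. -/
def wConstS {n m : ℕ} (rinv pinv : Fin m → ℝ)
    (w : Fin m → (Fin n → ℝ) → ℝ) : ℝ≥0∞ :=
  ⨆ Q : {Q : Set (Fin n → ℝ) // IsCube Q},
    ∏ j, avg (rinv j - pinv j) (fun x => (w j x)⁻¹) Q.1

/-- The multisublinear Hardy-Littlewood maximal operator
`M_{(r_1,…,r_m)}(f⃗)(x) = sup_{Q ∋ x} ∏_j ⟨f_j⟩_{r_j,Q}` (reciprocal exponents). -/
def maximal {n m : ℕ} (rinv : Fin m → ℝ)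
    (f : Fin m → (Fin n → ℝ) → ℝ) (x : Fin n → ℝ) : ℝ≥0∞ :=
  ⨆ Q : {Q : Set (Fin n → ℝ) // IsCube Q ∧ x ∈ Q}, ∏ j, avg (rinv j) (f j) Q.1

/-- A sparse family of cubes (with sparsity constant 2): to each cube `Q` of the family
is associated a major subset `E Q ⊆ Q` with `|Q| ≤ 2|E Q|`, and these sets are
pairwise disjoint. -/
structure SparseFamily (n : ℕ) where
  cubes : Set (Set (Fin n → ℝ))
  E : Set (Fin n → ℝ) → Set (Fin n → ℝ)
  isCube : ∀ Q ∈ cubes, IsCube Q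
  E_subset : ∀ Q ∈ cubes, E Q ⊆ Q
  E_meas : ∀ Q ∈ cubes, MeasurableSet (E Q)
  E_disj : ∀ Q ∈ cubes, ∀ Q' ∈ cubes, Q ≠ Q' → Disjoint (E Q) (E Q')
  density : ∀ Q ∈ cubes, volume Q ≤ 2 * volume (E Q)

/-- The sparse form `Λ_{r⃗,S}(f⃗) = ∑_{Q∈S} (∏_j ⟨f_j⟩_{r_j,Q}) |Q|`. -/
def sparseForm {n m : ℕ} (rinv : Fin m → ℝ) (S : SparseFamily n)
    (f : Fin m → (Fin n → ℝ) → ℝ) : ℝ≥0∞ :=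
  ∑' Q : S.cubes, (∏ j, avg (rinv j) (f j) Q.1) * volume Q.1

/-- The sparse operator `A_{r⃗,S}(f⃗) = ∑_{Q∈S} (∏_j ⟨f_j⟩_{r_j,Q}) χ_Q`. -/
def sparseOp {n m : ℕ} (rinv : Fin m → ℝ) (S : SparseFamily n)
    (f : Fin m → (Fin n → ℝ) → ℝ) (x : Fin n → ℝ) : ℝ≥0∞ :=
  ∑' Q : S.cubes, (∏ j, avg (rinv j) (f j) Q.1) *
    (Q.1).indicator (fun _ => (1 : ℝ≥0∞)) x

end Paper
namespace Paper

lemma lintegral_coord (S : Set ℝ) (F : ℝ → ℝ≥0∞) :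
    ∫⁻ x in {x : Fin 1 → ℝ | x 0 ∈ S}, F (x 0) = ∫⁻ t in S, F t :=
  (volume_preserving_funUnique (Fin 1) ℝ).setLIntegral_comp_preimage_emb
    (MeasurableEquiv.measurableEmbedding _) F S

lemma volume_coord (S : Set ℝ) : volume {x : Fin 1 → ℝ | x 0 ∈ S} = volume S := by
  simpa using lintegral_coord S (fun _ => 1)

lemma ae_coord_ne_zero : ∀ᵐ x : Fin 1 → ℝ, x 0 ≠ 0 := by
  have h := volume_coord {0}
  rw [ae_iff]
  simpa using h

lemma setLIntegral_rpow_Ioo {ε T : ℝ} (hε : 0 < ε) (hT : 0 ≤ T) :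
    ∫⁻ t in Set.Ioo 0 T, ENNReal.ofReal (t ^ (ε - 1)) = ENNReal.ofReal (T ^ ε / ε) := by
  have hi : IntervalIntegrable (fun t : ℝ => t ^ (ε - 1)) volume 0 T :=
    intervalIntegral.intervalIntegrable_rpow' (by linarith)
  rw [setLIntegral_congr Ioo_ae_eq_Ioc, ← ofReal_integral_eq_lintegral_ofReal
    ((intervalIntegrable_iff_integrableOn_Ioc_of_le hT).1 hi),
    ← intervalIntegral.integral_of_le hT, integral_rpow (Or.inl (by linarith))]
  · simp [hε.ne']
  · filter_upwards [ae_restrict_mem measurableSet_Ioc] with t ht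
    exact Real.rpow_nonneg ht.1.le _

lemma setLIntegral_abs_rpow_Icc_le {ε R : ℝ} (hε : 0 < ε) (hR : 0 ≤ R) :
    ∫⁻ t in Set.Icc (-R) R, ENNReal.ofReal (|t| ^ (ε - 1)) ≤ ENNReal.ofReal (2 * (R ^ ε / ε)) := by
  have hpos : ∫⁻ t in Set.Icc 0 R, ENNReal.ofReal (|t| ^ (ε - 1)) =
      ENNReal.ofReal (R ^ ε / ε) := by
    rw [← setLIntegral_rpow_Ioo hε hR, ← setLIntegral_congr Ioo_ae_eq_Icc]
    refine setLIntegral_congr_fun measurableSet_Ioo fun t ht => ?_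
    simp [abs_of_pos ht.1]
  have hneg : ∫⁻ t in Neg.neg ⁻¹' Set.Icc 0 R, ENNReal.ofReal (|t| ^ (ε - 1)) =
      ENNReal.ofReal (R ^ ε / ε) := by
    rw [← hpos, ← (Measure.measurePreserving_neg (volume : Measure ℝ)).setLIntegral_comp_preimage_emb
      (MeasurableEquiv.neg ℝ).measurableEmbedding]
    simp
  have hsub : Set.Icc (-R) R ⊆ (Neg.neg ⁻¹' Set.Icc 0 R) ∪ Set.Icc 0 R := by
    intro t ht
    rcases le_total t 0 with h | h
    · exact Or.inl ⟨by linarith, by linarith [ht.1]⟩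
    · exact Or.inr ⟨h, ht.2⟩
  calc _ ≤ _ := lintegral_mono_set hsub
    _ ≤ _ := lintegral_union_le _ _ _
    _ = _ := by
      rw [hpos, hneg, ← ENNReal.ofReal_add (by positivity) (by positivity)]
      ring_nf

lemma setLIntegral_abs_rpow_Ico_le {ε c h : ℝ} (hε : 0 < ε) (hε1 : ε ≤ 1) (hh : 0 < h) :
    ∫⁻ t in Set.Ico c (c + h), ENNReal.ofReal (|t| ^ (ε - 1)) ≤
      ENNReal.ofReal (4 / ε * max |c| |c + h| ^ (ε - 1) * h) := by
  set R := max |c| |c + h| with hRdef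
  have hc := le_max_left |c| |c + h|
  have hch := le_max_right |c| |c + h|
  rw [← hRdef] at hc hch
  have hR : 0 < R := by
    have h1 := neg_abs_le c
    have h2 := le_abs_self (c + h)
    linarith
  by_cases hfar : ∀ t ∈ Set.Ico c (c + h), R / 2 ≤ |t|
  · calc _ ≤ ∫⁻ t in Set.Ico c (c + h), ENNReal.ofReal (2 * R ^ (ε - 1)) := by
          refine setLIntegral_mono measurable_const fun t ht => ENNReal.ofReal_le_ofReal ?_
          calc |t| ^ (ε - 1) ≤ (R / 2) ^ (ε - 1) :=
                Real.rpow_le_rpow_of_nonpos (by positivity) (hfar t ht) (by linarith)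
            _ = 2 ^ (1 - ε) * R ^ (ε - 1) := by
                rw [Real.div_rpow hR.le (by norm_num), show 1 - ε = -(ε - 1) by ring,
                  Real.rpow_neg (by norm_num)]
                field_simp
            _ ≤ 2 ^ (1 : ℝ) * R ^ (ε - 1) := by
                gcongr
                · norm_num
                · linarith
            _ = _ := by simp
      _ = ENNReal.ofReal (2 * R ^ (ε - 1) * h) := by
          rw [setLIntegral_const, Real.volume_Ico, ← ENNReal.ofReal_mul (by positivity)]
          ring_nf
      _ ≤ _ := by
          refine ENNReal.ofReal_le_ofReal ?_
          gcongr
          rw [le_div_iff₀ hε]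
          linarith
  · push Not at hfar
    obtain ⟨t, ht, htR⟩ := hfar
    have hRh : R ≤ 2 * h := by
      have h1 := abs_lt.1 htR
      rcases le_max_iff.1 hRdef.le with h2 | h2
      · rcases abs_cases c with h3 | h3 <;> linarith [ht.1, ht.2]
      · rcases abs_cases (c + h) with h3 | h3 <;> linarith [ht.1, ht.2]
    calc _ ≤ ∫⁻ t in Set.Icc (-R) R, ENNReal.ofReal (|t| ^ (ε - 1)) :=
          lintegral_mono_set fun u hu =>
            ⟨by linarith [neg_abs_le c, hu.1], by linarith [le_abs_self (c + h), hu.2]⟩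
      _ ≤ _ := setLIntegral_abs_rpow_Icc_le hε hR.le
      _ ≤ _ := by
          refine ENNReal.ofReal_le_ofReal ?_
          have hs : R ^ ε = R ^ (ε - 1) * R := by
            rw [Real.rpow_sub_one hR.ne']; field_simp
          rw [hs]
          calc 2 * (R ^ (ε - 1) * R / ε) ≤ 2 * (R ^ (ε - 1) * (2 * h) / ε) := by gcongr
            _ = _ := by ring

lemma isCube_iff {Q : Set (Fin 1 → ℝ)} :
    IsCube Q ↔ ∃ c h : ℝ, 0 < h ∧ Q = {x | x 0 ∈ Set.Ico c (c + h)} := by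
  have key (c : Fin 1 → ℝ) (h : ℝ) : (Set.univ.pi fun i => Set.Ico (c i) (c i + h)) =
      {x | x 0 ∈ Set.Ico (c 0) (c 0 + h)} := by
    ext x
    simp [Set.mem_pi]
  constructor
  · rintro ⟨c, h, hh, rfl⟩
    exact ⟨c 0, h, hh, key c h⟩
  · rintro ⟨c, h, hh, rfl⟩
    exact ⟨fun _ => c, h, hh, (key (fun _ => c) h).symm⟩

lemma rpow_one_div_rpow {τ : ℝ} (hτ : τ ≠ 0) (a : ℝ≥0∞) : (a ^ (1 / τ)) ^ τ = a := by
  rw [← ENNReal.rpow_mul, one_div_mul_cancel hτ, ENNReal.rpow_one]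

lemma avg_le_ofReal {n : ℕ} {τ M : ℝ} (hτ : 0 ≤ τ) {f : (Fin n → ℝ) → ℝ} {Q : Set (Fin n → ℝ)}
    (hQ0 : volume Q ≠ 0) (hQ : volume Q ≠ ∞) (hf : ∀ᵐ x ∂volume.restrict Q, |f x| ≤ M) :
    avg τ f Q ≤ ENNReal.ofReal M := by
  have hf' : ∀ᵐ x ∂volume.restrict Q, ENNReal.ofReal |f x| ≤ ENNReal.ofReal M := by
    filter_upwards [hf] with x hx using ENNReal.ofReal_le_ofReal hx
  unfold avg
  split_ifs with h0
  · exact essSup_le_of_ae_le _ hf'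
  · have hle : ∫⁻ x in Q, ENNReal.ofReal |f x| ^ (1 / τ) ≤
        ∫⁻ _ in Q, ENNReal.ofReal M ^ (1 / τ) := by
      refine lintegral_mono_ae ?_
      filter_upwards [hf'] with x hx
      gcongr
    calc _ ≤ ((volume Q)⁻¹ * ∫⁻ _ in Q, ENNReal.ofReal M ^ (1 / τ)) ^ τ := by gcongr
      _ = _ := by
        rw [setLIntegral_const, mul_left_comm, ENNReal.inv_mul_cancel hQ0 hQ, mul_one,
          rpow_one_div_rpow h0]

lemma ofReal_le_avg {n : ℕ} {τ M : ℝ} (hτ : 0 < τ) {f : (Fin n → ℝ) → ℝ} {Q : Set (Fin n → ℝ)}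
    (hQ0 : volume Q ≠ 0) (hQ : volume Q ≠ ∞) (hf : ∀ᵐ x ∂volume.restrict Q, M ≤ |f x|) :
    ENNReal.ofReal M ≤ avg τ f Q := by
  have hle : ∫⁻ _ in Q, ENNReal.ofReal M ^ (1 / τ) ≤
      ∫⁻ x in Q, ENNReal.ofReal |f x| ^ (1 / τ) := by
    refine lintegral_mono_ae ?_
    filter_upwards [hf] with x hx
    gcongr
  unfold avg
  rw [if_neg hτ.ne']
  calc _ = ((volume Q)⁻¹ * ∫⁻ _ in Q, ENNReal.ofReal M ^ (1 / τ)) ^ τ := by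
        rw [setLIntegral_const, mul_left_comm, ENNReal.inv_mul_cancel hQ0 hQ, mul_one,
          rpow_one_div_rpow hτ.ne']
    _ ≤ _ := by gcongr

lemma volume_Ico_coord (c h : ℝ) :
    volume {x : Fin 1 → ℝ | x 0 ∈ Set.Ico c (c + h)} = ENNReal.ofReal h := by
  rw [volume_coord, Real.volume_Ico, add_sub_cancel_left]

/-- The power weight `|x|^e` on the line, with value `1` at the origin. -/
def powWeight (e : ℝ) (x : Fin 1 → ℝ) : ℝ := if x 0 = 0 then 1 else |x 0| ^ e

/-- The power function `x^e` on `(0, 1)`, extended by zero. -/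
def powUnit (e : ℝ) (x : Fin 1 → ℝ) : ℝ := if x 0 ∈ Set.Ioo 0 1 then x 0 ^ e else 0

lemma isWeight_powWeight (e : ℝ) : IsWeight (powWeight e) := by
  constructor
  · unfold powWeight
    exact Measurable.ite (measurableSet_eq_fun (by fun_prop) (by fun_prop)) measurable_const
      (by fun_prop)
  · intro x
    unfold powWeight
    split_ifs with h
    · exact one_pos
    · exact Real.rpow_pos_of_pos (abs_pos.2 h) _

lemma measurable_powUnit (e : ℝ) : Measurable (powUnit e) := by
  unfold powUnit
  exact Measurable.ite (measurableSet_Ioo.preimage (measurable_pi_apply 0)) (by fun_prop)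
    measurable_const

lemma powWeight_of_ne {e : ℝ} {x : Fin 1 → ℝ} (hx : x 0 ≠ 0) : powWeight e x = |x 0| ^ e :=
  if_neg hx

lemma powUnit_of_mem {e : ℝ} {x : Fin 1 → ℝ} (hx : x 0 ∈ Set.Ioo 0 1) :
    powUnit e x = x 0 ^ e := if_pos hx

lemma ofReal_rpow_mul_one_div {τ t e : ℝ} (hτ : τ ≠ 0) (ht : 0 < t) :
    ENNReal.ofReal (t ^ (e * τ)) ^ (1 / τ) = ENNReal.ofReal (t ^ e) := by
  rw [ENNReal.ofReal_rpow_of_pos (by positivity), ← Real.rpow_mul ht.le]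
  congr 2
  field_simp

lemma avg_inv_powWeight_le {ε τ c h : ℝ} (hε : 0 < ε) (hε1 : ε ≤ 1) (hτ : 0 < τ) (hh : 0 < h) :
    avg τ (fun x => (powWeight ((1 - ε) * τ) x)⁻¹) {x | x 0 ∈ Set.Ico c (c + h)} ≤
      ENNReal.ofReal ((4 / ε * max |c| |c + h| ^ (ε - 1)) ^ τ) := by
  have hint : ∫⁻ x in {x : Fin 1 → ℝ | x 0 ∈ Set.Ico c (c + h)},
      ENNReal.ofReal |(powWeight ((1 - ε) * τ) x)⁻¹| ^ (1 / τ) =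
      ∫⁻ t in Set.Ico c (c + h), ENNReal.ofReal (|t| ^ (ε - 1)) := by
    rw [← lintegral_coord]
    refine lintegral_congr_ae (ae_restrict_of_ae ?_)
    filter_upwards [ae_coord_ne_zero] with x hx
    have hx' : 0 < |x 0| := abs_pos.2 hx
    rw [powWeight_of_ne hx, ← Real.rpow_neg hx'.le, abs_of_pos (by positivity),
      show -((1 - ε) * τ) = (ε - 1) * τ by ring, ofReal_rpow_mul_one_div hτ.ne' hx']
  unfold avg
  rw [if_neg hτ.ne', hint, volume_Ico_coord, ← ENNReal.ofReal_rpow_of_nonneg (by positivity) hτ.le]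
  gcongr
  calc _ ≤ (ENNReal.ofReal h)⁻¹ * ENNReal.ofReal (4 / ε * max |c| |c + h| ^ (ε - 1) * h) := by
        gcongr
        exact setLIntegral_abs_rpow_Ico_le hε hε1 hh
    _ = _ := by
        rw [ENNReal.ofReal_mul (by positivity), mul_left_comm,
          ENNReal.inv_mul_cancel (by simpa using hh) ENNReal.ofReal_ne_top, mul_one]

lemma avg_powUnit {ε a T : ℝ} (hε : 0 < ε) (ha : 0 < a) (hT : 0 < T) (hT1 : T ≤ 1) :
    avg a (powUnit ((ε - 1) * a)) {x | x 0 ∈ Set.Ico 0 (0 + T)} =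
      ENNReal.ofReal ((T ^ (ε - 1) / ε) ^ a) := by
  have hint : ∫⁻ x in {x : Fin 1 → ℝ | x 0 ∈ Set.Ico 0 (0 + T)},
      ENNReal.ofReal |powUnit ((ε - 1) * a) x| ^ (1 / a) = ENNReal.ofReal (T ^ ε / ε) := by
    rw [← setLIntegral_rpow_Ioo hε hT.le, setLIntegral_congr Ioo_ae_eq_Ico, zero_add,
      ← lintegral_coord]
    refine lintegral_congr_ae ?_
    filter_upwards [ae_restrict_of_ae ae_coord_ne_zero,
      ae_restrict_mem (measurableSet_Ico.preimage (measurable_pi_apply 0))] with x hx hxT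
    have hx' : 0 < x 0 := lt_of_le_of_ne hxT.1 hx.symm
    rw [powUnit_of_mem ⟨hx', hxT.2.trans_le hT1⟩, abs_of_pos (by positivity),
      ofReal_rpow_mul_one_div ha.ne' hx']
  unfold avg
  rw [if_neg ha.ne', hint, volume_Ico_coord, ← ENNReal.ofReal_inv_of_pos hT,
    ← ENNReal.ofReal_mul (by positivity), ENNReal.ofReal_rpow_of_nonneg (by positivity) ha.le,
    Real.rpow_sub_one hT.ne']
  congr 2
  field_simp

lemma ofReal_le_avg_powUnit {e a T : ℝ} (he : e ≤ 0) (ha : 0 < a) (hT : 0 < T) (hT1 : T ≤ 1) :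
    ENNReal.ofReal (T ^ e) ≤ avg a (powUnit e) {x | x 0 ∈ Set.Ico 0 (0 + T)} := by
  refine ofReal_le_avg ha (by rw [volume_Ico_coord]; simpa using hT)
    (by rw [volume_Ico_coord]; exact ENNReal.ofReal_ne_top) ?_
  filter_upwards [ae_restrict_of_ae ae_coord_ne_zero,
    ae_restrict_mem (measurableSet_Ico.preimage (measurable_pi_apply 0))] with x hx hxT
  rw [zero_add] at hxT
  have hx' : 0 < x 0 := lt_of_le_of_ne hxT.1 hx.symm
  rw [powUnit_of_mem ⟨hx', hxT.2.trans_le hT1⟩]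
  exact (Real.rpow_le_rpow_of_nonpos hx' hxT.2.le he).trans (le_abs_self _)

lemma wnorm_powUnit_powWeight_le {ε b θ : ℝ} (hε : 0 < ε) (hb : 0 ≤ b) :
    wnorm b (powUnit ((ε - 1) * (b + θ))) (powWeight ((1 - ε) * θ)) ≤
      ENNReal.ofReal ((1 / ε) ^ b) := by
  have hmul : (fun x => powUnit ((ε - 1) * (b + θ)) x * powWeight ((1 - ε) * θ) x) =
      powUnit ((ε - 1) * b) := by
    funext x
    by_cases hx : x 0 ∈ Set.Ioo 0 1
    · rw [powUnit_of_mem hx, powUnit_of_mem hx, powWeight_of_ne hx.1.ne', abs_of_pos hx.1,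
        ← Real.rpow_add hx.1]
      ring_nf
    · simp [powUnit, hx]
  unfold wnorm
  rw [hmul]
  rcases hb.eq_or_lt with rfl | hb
  · rw [expOf, if_pos rfl, eLpNorm_exponent_top]
    refine (eLpNormEssSup_le_of_ae_bound (C := 1) (Filter.Eventually.of_forall fun x => ?_)).trans
      (by simp)
    unfold powUnit
    split_ifs <;> simp
  · have hp : 0 < 1 / b := by positivity
    rw [expOf, if_neg hb.ne', eLpNorm_eq_lintegral_rpow_enorm_toReal (by simpa using hb)
      ENNReal.ofReal_ne_top, ENNReal.toReal_ofReal hp.le, one_div_one_div]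
    have hint : ∫⁻ x, ‖powUnit ((ε - 1) * b) x‖ₑ ^ (1 / b) =
        ∫⁻ t in Set.Ioo 0 1, ENNReal.ofReal (t ^ (ε - 1)) := by
      have hm : MeasurableSet {x : Fin 1 → ℝ | x 0 ∈ Set.Ioo 0 1} :=
        measurableSet_Ioo.preimage (measurable_pi_apply 0)
      rw [← lintegral_coord, ← lintegral_indicator hm]
      refine lintegral_congr fun x => ?_
      by_cases hx : x 0 ∈ Set.Ioo 0 1
      · rw [Set.indicator_of_mem (by exact hx), powUnit_of_mem hx, Real.enorm_eq_ofReal_abs,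
          abs_of_pos (Real.rpow_pos_of_pos hx.1 _), ofReal_rpow_mul_one_div hb.ne' hx.1]
      · rw [Set.indicator_of_notMem (by exact hx), powUnit, if_neg hx, enorm_zero,
          ENNReal.zero_rpow_of_pos hp]
    rw [hint, setLIntegral_rpow_Ioo hε zero_le_one, Real.one_rpow,
      ENNReal.ofReal_rpow_of_nonneg (by positivity) hb.le]

lemma ofReal_le_wnormE {ε b A T : ℝ} (hε : 0 < ε) (hb : 0 ≤ b) (hA : 0 ≤ A) (hT : 0 < T)
    {g : (Fin 1 → ℝ) → ℝ≥0∞} {w : (Fin 1 → ℝ) → ℝ}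
    (hg : ∀ x, x 0 ∈ Set.Ioo 0 T →
      ENNReal.ofReal (A * x 0 ^ ((ε - 1) * b)) ≤ g x * ENNReal.ofReal (w x)) :
    ENNReal.ofReal (A * (T ^ ε / ε) ^ b) ≤ wnormE b g w := by
  have hm : MeasurableSet {x : Fin 1 → ℝ | x 0 ∈ Set.Ioo 0 T} :=
    measurableSet_Ioo.preimage (measurable_pi_apply 0)
  unfold wnormE
  rcases hb.eq_or_lt with rfl | hb
  · have hne : volume.restrict {x : Fin 1 → ℝ | x 0 ∈ Set.Ioo 0 T} ≠ 0 := by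
      rw [Ne, Measure.restrict_eq_zero, volume_coord]
      simpa using hT
    rw [if_pos rfl, Real.rpow_zero, mul_one, ← essSup_const (ENNReal.ofReal A) hne]
    refine le_trans (essSup_mono_ae ?_) (essSup_mono_measure' Measure.restrict_le_self)
    filter_upwards [ae_restrict_mem hm] with x hx
    simpa using hg x hx
  · rw [if_neg hb.ne']
    have hle : ENNReal.ofReal A ^ (1 / b) * ENNReal.ofReal (T ^ ε / ε) ≤
        ∫⁻ x, (g x * ENNReal.ofReal (w x)) ^ (1 / b) := by
      rw [← setLIntegral_rpow_Ioo hε hT.le, ← lintegral_const_mul' _ _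
        (ENNReal.rpow_ne_top_of_nonneg (by positivity) ENNReal.ofReal_ne_top),
        ← lintegral_coord (Set.Ioo 0 T) (fun t => ENNReal.ofReal A ^ (1 / b) *
          ENNReal.ofReal (t ^ (ε - 1)))]
      refine le_trans (lintegral_mono_ae ?_) (setLIntegral_le_lintegral _ _)
      filter_upwards [ae_restrict_mem hm] with x hx
      have hx' : x 0 ∈ Set.Ioo 0 T := hx
      rw [← ofReal_rpow_mul_one_div hb.ne' hx'.1,
        ← ENNReal.mul_rpow_of_nonneg _ _ (by positivity : 0 ≤ 1 / b), ← ENNReal.ofReal_mul hA]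
      gcongr
      exact hg x hx
    calc _ = (ENNReal.ofReal A ^ (1 / b) * ENNReal.ofReal (T ^ ε / ε)) ^ b := by
          rw [ENNReal.mul_rpow_of_nonneg _ _ hb.le, rpow_one_div_rpow hb.ne',
            ENNReal.ofReal_rpow_of_nonneg (by positivity) hb.le, ENNReal.ofReal_mul hA]
      _ ≤ _ := by gcongr

/-- The weights `|x|^{(1-ε)τ_k}` in the `k`-th slot and `1` elsewhere. -/
def extremalWeight {m : ℕ} (k : Fin m) (ε τ : ℝ) (j : Fin m) : (Fin 1 → ℝ) → ℝ :=
  powWeight ((1 - ε) * if j = k then τ else 0)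

lemma powWeight_zero (x : Fin 1 → ℝ) : powWeight 0 x = 1 := by
  unfold powWeight
  split_ifs <;> simp

lemma prod_extremalWeight {m : ℕ} (k : Fin m) (ε τ : ℝ) (x : Fin 1 → ℝ) :
    ∏ j, extremalWeight k ε τ j x = powWeight ((1 - ε) * τ) x := by
  rw [Finset.prod_eq_single k]
  · simp [extremalWeight]
  · intro j _ hj
    simp [extremalWeight, hj, powWeight_zero]
  · simp

lemma wConst_extremalWeight_le {m : ℕ} {rinv pinv : Fin m → ℝ} (hp0 : ∀ j, 0 ≤ pinv j)
    (hpr : ∀ j, pinv j < rinv j) (k : Fin m) {ε : ℝ} (hε : 0 < ε) (hε1 : ε ≤ 1) :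
    wConst rinv pinv 0 (extremalWeight k ε (rinv k - pinv k)) ≤
      ENNReal.ofReal ((4 / ε) ^ (rinv k - pinv k)) := by
  refine iSup_le fun ⟨Q, hQ⟩ => ?_
  obtain ⟨c, h, hh, rfl⟩ := isCube_iff.1 hQ
  set τ := rinv k - pinv k with hτdef
  have hτ : 0 < τ := sub_pos.2 (hpr k)
  set Q : Set (Fin 1 → ℝ) := {x | x 0 ∈ Set.Ico c (c + h)} with hQdef
  have hQ0 : volume Q ≠ 0 := by rw [hQdef, volume_Ico_coord]; simpa using hh
  have hQt : volume Q ≠ ∞ := by rw [hQdef, volume_Ico_coord]; exact ENNReal.ofReal_ne_top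
  set R := max |c| |c + h| with hRdef
  have hR : 0 < R := by
    rcases eq_or_ne c 0 with rfl | hc
    · exact lt_max_of_lt_right (by simpa using hh.ne')
    · exact lt_max_of_lt_left (abs_pos.2 hc)
  have hprod : ∏ j, avg (rinv j - pinv j) (fun x => (extremalWeight k ε τ j x)⁻¹) Q ≤
      ENNReal.ofReal ((4 / ε * R ^ (ε - 1)) ^ τ) := by
    rw [← Finset.mul_prod_erase _ _ (Finset.mem_univ k)]
    refine le_trans (mul_le_mul' ?_ (Finset.prod_le_one' fun j hj => ?_)) (mul_one _).le
    · simp only [extremalWeight, if_true]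
      exact avg_inv_powWeight_le hε hε1 hτ hh
    · refine (avg_le_ofReal (sub_pos.2 (hpr j)).le hQ0 hQt (M := 1)
        (Filter.Eventually.of_forall fun x => ?_)).trans (by simp)
      simp [extremalWeight, (Finset.mem_erase.1 hj).1, powWeight_zero]
  have hw : avg ((∑ j, pinv j) - 0) (fun x => ∏ j, extremalWeight k ε τ j x) Q ≤
      ENNReal.ofReal (R ^ ((1 - ε) * τ)) := by
    refine avg_le_ofReal (by simpa using Finset.sum_nonneg fun j _ => hp0 j) hQ0 hQt ?_
    filter_upwards [ae_restrict_of_ae ae_coord_ne_zero,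
      ae_restrict_mem (measurableSet_Ico.preimage (measurable_pi_apply 0))] with x hx hxQ
    rw [prod_extremalWeight, powWeight_of_ne hx, abs_of_nonneg (by positivity)]
    exact Real.rpow_le_rpow (abs_nonneg _) (abs_le_max_abs_abs hxQ.1 hxQ.2.le)
      (mul_nonneg (by linarith) hτ.le)
  refine (mul_le_mul' hprod hw).trans_eq ?_
  rw [← ENNReal.ofReal_mul (by positivity), Real.mul_rpow (by positivity) (by positivity),
    ← Real.rpow_mul hR.le, mul_assoc, ← Real.rpow_add hR]
  ring_nf
  simp

lemma ofReal_le_maximal_mul {m : ℕ} {rinv pinv : Fin m → ℝ} (hr : ∀ j, 0 < rinv j)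
    (hp0 : ∀ j, 0 ≤ pinv j) (hpr : ∀ j, pinv j < rinv j) (k : Fin m) {ε : ℝ} (hε : 0 < ε)
    (hε1 : ε ≤ 1) {x : Fin 1 → ℝ} (hx : x 0 ∈ Set.Ioo 0 (1 / 2)) :
    ENNReal.ofReal (2 ^ (-(∑ j, pinv j + (rinv k - pinv k))) * (1 / ε) ^ rinv k *
        x 0 ^ ((ε - 1) * ∑ j, pinv j)) ≤
      maximal rinv (fun j => powUnit ((ε - 1) * (pinv j + if j = k then rinv k - pinv k else 0))) x *
        ENNReal.ofReal (∏ j, extremalWeight k ε (rinv k - pinv k) j x) := by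
  set τ := rinv k - pinv k with hτdef
  have hτ : 0 < τ := sub_pos.2 (hpr k)
  set b := ∑ j, pinv j with hbdef
  have hb : 0 ≤ b := Finset.sum_nonneg fun j _ => hp0 j
  obtain ⟨hx0, hx1⟩ := hx
  have hT : 0 < 2 * x 0 := by positivity
  have hT1 : 2 * x 0 ≤ 1 := by linarith
  have hmax : ENNReal.ofReal ((2 * x 0) ^ ((ε - 1) * (b + τ)) * (1 / ε) ^ rinv k) ≤
      maximal rinv (fun j => powUnit ((ε - 1) * (pinv j + if j = k then τ else 0))) x := by
    refine le_trans ?_ (le_iSup _ ⟨{z | z 0 ∈ Set.Ico 0 (0 + 2 * x 0)},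
      isCube_iff.2 ⟨0, _, hT, rfl⟩, ?_⟩)
    · have hprod : (2 * x 0) ^ ((ε - 1) * (b + τ)) * (1 / ε) ^ rinv k =
          ∏ j, (2 * x 0) ^ ((ε - 1) * (pinv j + if j = k then τ else 0)) *
            (if j = k then (1 / ε) ^ rinv k else 1) := by
        rw [Finset.prod_mul_distrib, ← Real.rpow_sum_of_pos hT, ← Finset.mul_sum,
          Finset.sum_add_distrib]
        simp [hbdef]
      rw [hprod, ENNReal.ofReal_prod_of_nonneg (fun j _ => by split_ifs <;> positivity)]
      refine Finset.prod_le_prod' fun j _ => ?_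
      by_cases hj : j = k
      · subst hj
        simp only [if_true]
        rw [show pinv j + τ = rinv j by rw [hτdef]; ring, avg_powUnit hε (hr j) hT hT1,
          div_eq_mul_one_div ((2 * x 0) ^ (ε - 1)), Real.rpow_mul hT.le,
          ← Real.mul_rpow (Real.rpow_nonneg hT.le _) (by positivity)]
      · simp only [hj, if_false, add_zero, mul_one]
        exact ofReal_le_avg_powUnit (mul_nonpos_of_nonpos_of_nonneg (by linarith) (hp0 j))
          (hr j) hT hT1
    · simp only [Set.mem_ofPred_eq, Set.mem_Ico]
      constructor <;> linarith
  refine le_trans ?_ (mul_le_mul' hmax le_rfl)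
  rw [prod_extremalWeight, powWeight_of_ne hx0.ne', abs_of_pos hx0,
    ← ENNReal.ofReal_mul (by positivity)]
  refine ENNReal.ofReal_le_ofReal ?_
  have hsplit : x 0 ^ ((ε - 1) * b) = x 0 ^ ((ε - 1) * (b + τ)) * x 0 ^ ((1 - ε) * τ) := by
    rw [← Real.rpow_add hx0]; ring_nf
  have h2 : (2 : ℝ) ^ (-(b + τ)) ≤ 2 ^ ((ε - 1) * (b + τ)) :=
    Real.rpow_le_rpow_of_exponent_le (by norm_num) (by nlinarith)
  rw [hsplit, Real.mul_rpow (by norm_num) hx0.le]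
  calc _ = 2 ^ (-(b + τ)) *
        (x 0 ^ ((ε - 1) * (b + τ)) * (1 / ε) ^ rinv k * x 0 ^ ((1 - ε) * τ)) := by ring
    _ ≤ 2 ^ ((ε - 1) * (b + τ)) *
        (x 0 ^ ((ε - 1) * (b + τ)) * (1 / ε) ^ rinv k * x 0 ^ ((1 - ε) * τ)) := by gcongr
    _ = _ := by ring

lemma le_of_forall_rpow_le_mul_rpow {a b K : ℝ} (h : ∀ y : ℝ, 1 ≤ y → y ^ a ≤ K * y ^ b) :
    a ≤ b := by
  by_contra! hab
  have ht := tendsto_rpow_atTop (sub_pos.2 hab)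
  obtain ⟨y, hy, hy1⟩ :=
    ((ht.eventually_gt_atTop K).and (Filter.eventually_ge_atTop (1 : ℝ))).exists
  have hy0 : 0 < y := by linarith
  rw [Real.rpow_sub hy0, lt_div_iff₀ (by positivity)] at hy
  exact absurd (h y hy1) (not_le.2 hy)

/-- **Sharpness of the exponent in the multilinear Buckley bound** (optimality part of
Proposition 2.15, in dimension `n = 1`): if the bound
`‖M_{r⃗}(f⃗)‖_{L^p(w^p)} ≤ C [w⃗]_{p⃗,(r⃗,∞)}^α ∏_j ‖f_j‖_{L^{p_j}(w_j^{p_j})}` holds for all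
weights with finite constant and all `f_j ∈ L^{p_j}(w_j^{p_j})`, then
`α ≥ max_j (1/r_j)/(1/r_j - 1/p_j)`. -/
theorem buckley_exponent_sharpness
    (m : ℕ) (hm : 0 < m) (rinv pinv : Fin m → ℝ)
    (hr : ∀ j, 0 < rinv j) (hp0 : ∀ j, 0 ≤ pinv j) (hpr : ∀ j, pinv j < rinv j)
    (α : ℝ) (hα : 0 ≤ α) (C : ℝ≥0∞) (hC0 : 0 < C) (hC : C < ∞)
    (H : ∀ w : Fin m → (Fin 1 → ℝ) → ℝ, (∀ j, IsWeight (w j)) →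
      wConst rinv pinv 0 w < ∞ →
      ∀ f : Fin m → (Fin 1 → ℝ) → ℝ, (∀ j, Measurable (f j)) →
        (∀ j, wnorm (pinv j) (f j) (w j) < ∞) →
        wnormE (∑ j, pinv j) (maximal rinv f) (fun x => ∏ j, w j x) ≤
          C * wConst rinv pinv 0 w ^ α * ∏ j, wnorm (pinv j) (f j) (w j)) :
    (Finset.univ.sup' ⟨⟨0, hm⟩, Finset.mem_univ _⟩ fun j =>
      rinv j / (rinv j - pinv j)) ≤ α := by
  refine Finset.sup'_le _ _ fun k _ => ?_
  set τ := rinv k - pinv k with hτdef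
  have hτ : 0 < τ := sub_pos.2 (hpr k)
  set b := ∑ j, pinv j with hbdef
  have hb : 0 ≤ b := Finset.sum_nonneg fun j _ => hp0 j
  rw [div_le_iff₀ hτ]
  refine le_of_forall_rpow_le_mul_rpow
    (K := C.toReal * 4 ^ (α * τ) / (2 ^ (-(b + τ)) * (1 / 2) ^ b)) fun y hy => ?_
  have hy0 : 0 < y := by linarith
  obtain ⟨ε, rfl⟩ : ∃ ε, y = 1 / ε := ⟨1 / y, by simp⟩
  have hε : 0 < ε := one_div_pos.1 hy0
  have hε1 : ε ≤ 1 := by rwa [le_div_iff₀ hε, one_mul] at hy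
  have hwc := wConst_extremalWeight_le hp0 hpr k hε hε1
  have hn (j : Fin m) := wnorm_powUnit_powWeight_le (θ := if j = k then τ else 0) hε (hp0 j)
  have hbound := H (extremalWeight k ε τ) (fun j => isWeight_powWeight _)
    (hwc.trans_lt ENNReal.ofReal_lt_top)
    (fun j => powUnit ((ε - 1) * (pinv j + if j = k then τ else 0)))
    (fun j => measurable_powUnit _) (fun j => (hn j).trans_lt ENNReal.ofReal_lt_top)
  have hlow := ofReal_le_wnormE hε hb (T := 1 / 2) (by positivity) (by norm_num)
    (fun x hx => ofReal_le_maximal_mul hr hp0 hpr k hε hε1 hx)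
  have hup : C * wConst rinv pinv 0 (extremalWeight k ε τ) ^ α *
      ∏ j, wnorm (pinv j) (powUnit ((ε - 1) * (pinv j + if j = k then τ else 0)))
        (extremalWeight k ε τ j) ≤
      ENNReal.ofReal (C.toReal * ((4 / ε) ^ τ) ^ α * (1 / ε) ^ b) := by
    rw [ENNReal.ofReal_mul (by positivity), ENNReal.ofReal_mul (by positivity),
      ENNReal.ofReal_toReal hC.ne, ← ENNReal.ofReal_rpow_of_nonneg (by positivity) hα, hbdef,
      Real.rpow_sum_of_pos hy0, ENNReal.ofReal_prod_of_nonneg (fun j _ => by positivity)]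
    gcongr with j _
    exact hn j
  have hreal := (ENNReal.ofReal_le_ofReal_iff (by positivity)).1 ((hlow.trans hbound).trans hup)
  have hhalf : (1 / 2 : ℝ) ≤ (1 / 2) ^ ε :=
    Real.self_le_rpow_of_le_one (by norm_num) (by norm_num) hε1
  have hlast : 2 ^ (-(b + τ)) * (1 / ε) ^ rinv k * ((1 / 2) ^ b * (1 / ε) ^ b) ≤
      C.toReal * (4 ^ (α * τ) * (1 / ε) ^ (α * τ)) * (1 / ε) ^ b := by
    calc _ = 2 ^ (-(b + τ)) * (1 / ε) ^ rinv k * ((1 / 2) / ε) ^ b := by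
          rw [← Real.mul_rpow (by norm_num) hy0.le, mul_one_div]
      _ ≤ 2 ^ (-(b + τ)) * (1 / ε) ^ rinv k * ((1 / 2) ^ ε / ε) ^ b := by gcongr
      _ ≤ _ := hreal
      _ = _ := by
          rw [← Real.rpow_mul (by positivity), mul_comm τ α, div_eq_mul_one_div 4 ε,
            Real.mul_rpow (by norm_num) hy0.le]
  rw [div_mul_eq_mul_div, le_div_iff₀ (by positivity)]
  refine le_of_mul_le_mul_right ?_ (Real.rpow_pos_of_pos hy0 b)
  linarith

end Paper
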